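/- Let F be a field of characteristic p, R = F[x_1,…,x_n], and let f_1,…,f_r ∈ R and positive integers a_1,…,a_r with p ∤ a_i for all i, such that for every pair i ≠ j the pair f_i, f_j is a regular sequence in R. Suppose ω ∈ Ω^k and α ∈ Ω^{k-1} satisfy f_1⋯f_r · ω = ( Σ_{i=1}^r a_i f_1⋯f_{i-1}f_{i+1}⋯f_r · df_i ) ∧ α. Then for each i = 1,…,r, every coefficient of the k-form df_i ∧ α lies in the principal ideal (f_i), i.e. df_i ∧ α ∈ f_i·Ω^k. -/

import Mathlib

set_option synthInstance.maxHeartbeats 1000000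
set_option maxHeartbeats 1000000
open MvPolynomial

/-- The polynomial ring `𝔽_q[x_1,…,x_n]`. -/
abbrev PolyRing (F : Type) [Field F] (n : ℕ) : Type := MvPolynomial (Fin n) F

/-- The exterior algebra over `R = F[x_1,…,x_n]` of the free module on `dx_1,…,dx_n`;
the module of differential `k`-forms `Ω^k` is its degree-`k` part. -/
abbrev FormAlgebra (F : Type) [Field F] (n : ℕ) : Type :=
  ExteriorAlgebra (PolyRing F n) (Fin n → PolyRing F n)

/-- `dg = Σ_i (∂g/∂x_i) dx_i` as an element of the exterior algebra. -/
noncomputable def dform {F : Type} [Field F] {n : ℕ} (g : PolyRing F n) : FormAlgebra F n :=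
  ExteriorAlgebra.ι (PolyRing F n) (fun j => MvPolynomial.pderiv j g)

/-- `c · dx_{s 0} ∧ ⋯ ∧ dx_{s (k-1)}`. -/
noncomputable def wedgeMonomial {F : Type} [Field F] {n : ℕ} (k : ℕ) (s : Fin k → Fin n)
    (c : PolyRing F n) : FormAlgebra F n :=
  c • (List.ofFn fun i => ExteriorAlgebra.ι (PolyRing F n)
        (Pi.single (s i) (1 : PolyRing F n))).prod

/-- `ω` is a differential `k`-form, i.e. an `R`-linear combination of `k`-fold wedge
products of the `dx_i`. -/
def IsForm {F : Type} [Field F] {n : ℕ} (k : ℕ) (ω : FormAlgebra F n) : Prop :=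
  ω ∈ AddSubgroup.closure {x | ∃ (s : Fin k → Fin n) (c : PolyRing F n), x = wedgeMonomial k s c}

/-- `ω` is a homogeneous `k`-form whose coefficients are homogeneous polynomials of degree `d`. -/
def IsHomogeneousForm {F : Type} [Field F] {n : ℕ} (k d : ℕ) (ω : FormAlgebra F n) : Prop :=
  ω ∈ AddSubgroup.closure {x | ∃ (s : Fin k → Fin n) (c : PolyRing F n),
    c.IsHomogeneous d ∧ x = wedgeMonomial k s c}

/-- The system of homogeneous equations `g i = 0` defines a smooth complete intersection
in `P^{n-1}`: over an algebraic closure, the only common zero of the `g i` in affine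
`n`-space at which the differentials `d(g i)` are linearly dependent is the origin. -/
def IsSmoothCI {F : Type} [Field F] {n : ℕ} {ι : Type} (g : ι → PolyRing F n) : Prop :=
  ∀ x : Fin n → AlgebraicClosure F,
    (∀ i, MvPolynomial.eval x
      (MvPolynomial.map (algebraMap F (AlgebraicClosure F)) (g i)) = 0) →
    ¬ LinearIndependent (AlgebraicClosure F)
      (fun i => fun j : Fin n => MvPolynomial.eval x
        (MvPolynomial.map (algebraMap F (AlgebraicClosure F)) (MvPolynomial.pderiv j (g i)))) →
    x = 0

/-- `df_{i_1} ∧ ⋯ ∧ df_{i_l}` for the increasing enumeration `i_1 < ⋯ < i_l` of `s`. -/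
noncomputable def dWedge {F : Type} [Field F] {n : ℕ} {r : ℕ} (g : Fin r → PolyRing F n)
    (s : Finset (Fin r)) : FormAlgebra F n :=
  ((s.sort (· ≤ ·)).map fun i => dform (g i)).prod

/-- The polynomial form `(Σ_i a_i (∏_j f_j^{expo j}) df_i/f_i) ∧ Ω_{i_1⋯i_l}`, where
`Ω_{i_1⋯i_l} = (df_{i_1}/f_{i_1}) ∧ ⋯ ∧ (df_{i_l}/f_{i_l})` and `s = {i_1 < ⋯ < i_l}`;
all denominators cancel provided `expo j ≥ 1` for all `j`. -/
noncomputable def clearedThetaOmega {F : Type} [Field F] {n : ℕ} {r : ℕ}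
    (g : Fin r → PolyRing F n) (a : Fin r → ℕ) (expo : Fin r → ℕ) (s : Finset (Fin r)) :
    FormAlgebra F n :=
  ∑ i ∈ sᶜ, ((a i : PolyRing F n) *
      ∏ j, g j ^ (expo j - (if j ∈ insert i s then 1 else 0))) • (dform (g i) * dWedge g s)

/-- The exterior algebra of a free module is free. -/
theorem ExteriorAlgebra.free_of_free (R M : Type*) [CommRing R] [AddCommGroup M] [Module R M]
    [Module.Free R M] : Module.Free R (ExteriorAlgebra R M) := by
  obtain ⟨I, b⟩ := Module.Free.exists_basis R M
  classical
  let : LinearOrder I := linearOrderOfSTO WellOrderingRel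
  exact Module.Free.of_basis b.ExteriorAlgebra

theorem ExteriorAlgebra.ιInv_algebraMap {R M : Type*} [CommRing R] [AddCommGroup M] [Module R M]
    (r : R) : ιInv (algebraMap R (ExteriorAlgebra R M) r) = 0 := by
  simp only [ιInv, LinearMap.comp_apply, AlgHom.toLinearMap_apply, AlgHom.commutes]
  rfl

/-- If `s` is a nonzerodivisor modulo `t`, then it is a nonzerodivisor on `M / tM` for every
free module `M`. -/
theorem Module.Free.exists_eq_smul_of_smul_eq_smul {R M : Type*} [CommRing R] [AddCommGroup M]
    [Module R M] [Module.Free R M] {s t : R} (h : ∀ x, t ∣ s * x → t ∣ x) {m m' : M}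
    (e : s • m = t • m') : ∃ m'', m = t • m'' := by
  obtain ⟨I, b⟩ := Module.Free.exists_basis R M
  have hd : ∀ i, t ∣ b.repr m i := fun i => h _ ⟨b.repr m' i, by
    simpa using congr(b.repr $e i)⟩
  choose c hc using hd
  refine ⟨∑ i ∈ (b.repr m).support, c i • b i, ?_⟩
  conv_lhs => rw [← b.linearCombination_repr m, Finsupp.linearCombination_apply, Finsupp.sum]
  simp_rw [Finset.smul_sum, smul_smul, ← hc]

theorem RingTheory.Sequence.IsRegular.dvd_of_dvd_mul {R : Type*} [CommRing R] {s t : R}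
    (h : IsRegular R [t, s]) {x : R} (hx : t ∣ s * x) : t ∣ x := by
  have hs : IsSMulRegular (QuotSMulTop t R) s :=
    ((isWeaklyRegular_cons_iff R t [s]).1 h.toIsWeaklyRegular).2 |>
      (isWeaklyRegular_singleton_iff _ s).1
  have key : ∀ y : R, (Submodule.Quotient.mk y : QuotSMulTop t R) = 0 ↔ t ∣ y := fun y => by
    rw [Submodule.Quotient.mk_eq_zero, Submodule.mem_smul_pointwise_iff_exists]
    simp [dvd_def, eq_comm]
  rw [← key] at hx ⊢
  exact hs (hx.trans (smul_zero s).symm)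

/-- If a polynomial divides one of its partial derivatives, then that derivative vanishes. -/
theorem MvPolynomial.pderiv_eq_zero_of_dvd {σ R : Type*} [CommRing R] [IsDomain R]
    {f : MvPolynomial σ R} {i : σ} (h : f ∣ pderiv i f) : pderiv i f = 0 := by
  classical
  by_contra h0
  have hle := totalDegree_le_of_dvd_of_isDomain h h0
  have hpos : f.totalDegree ≠ 0 := fun hz => h0 (by
    rw [totalDegree_eq_zero_iff_eq_C.1 hz, pderiv_C])
  have hlt : (pderiv i f).totalDegree ≤ f.totalDegree - 1 := by
    conv_lhs => rw [f.as_sum, map_sum]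
    refine totalDegree_finsetSum_le fun m hm => ?_
    rw [pderiv_monomial]
    by_cases hmi : m i = 0
    · simp [hmi]
    refine (totalDegree_monomial_le _ _).trans ?_
    have hm' := le_totalDegree hm
    have hsub : (m - Finsupp.single i 1).degree + 1 = m.degree := by
      conv_rhs => rw [← tsub_add_cancel_of_le
        (Finsupp.single_le_iff.2 (Nat.one_le_iff_ne_zero.2 hmi))]
      simp
    change m.degree ≤ _ at hm'
    change (m - Finsupp.single i 1).degree ≤ _
    omega
  omega

theorem isForm_iff_mem_exteriorPower {F : Type} [Field F] {n k : ℕ} {ω : FormAlgebra F n} :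
    IsForm k ω ↔ ω ∈ ⋀[PolyRing F n]^k (Fin n → PolyRing F n) := by
  constructor
  · intro h
    refine (AddSubgroup.closure_le
      (Submodule.toAddSubgroup (⋀[PolyRing F n]^k (Fin n → PolyRing F n)))).2 ?_ h
    rintro _ ⟨s, c, rfl⟩
    exact Submodule.smul_mem _ _ (ExteriorAlgebra.ιMulti_range _ k
      ⟨fun i => Pi.single (s i) 1, ExteriorAlgebra.ιMulti_apply _⟩)
  · intro h
    rw [← exteriorPower.ιMulti_span_fixedDegree_of_span_eq_top _ k _
      (Pi.basisFun (PolyRing F n) (Fin n)).span_eq] at h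
    refine Submodule.closure_induction (p := fun x _ => IsForm k x) (AddSubgroup.zero_mem _)
      (fun _ _ _ _ hx hy => AddSubgroup.add_mem _ hx hy) ?_ h
    rintro c _ ⟨v, hv, rfl⟩
    choose s hs using fun i => hv ⟨i, rfl⟩
    refine AddSubgroup.subset_closure ⟨s, c, ?_⟩
    simp [wedgeMonomial, ExteriorAlgebra.ιMulti_apply, ← hs]

/-- The conclusion without control of the degree of the quotient, for an arbitrary
element `α` of the exterior algebra. -/
theorem exists_dform_mul_eq_smul {F : Type} [Field F] {n r : ℕ}
    {g : Fin r → PolyRing F n} {a : Fin r → ℕ} (ha : ∀ i, (a i : F) ≠ 0)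
    (hreg : ∀ i j : Fin r, i ≠ j → RingTheory.Sequence.IsRegular (PolyRing F n) [g i, g j])
    {ω α : FormAlgebra F n}
    (heq : (∏ i, g i) • ω =
      (∑ i, ((a i : PolyRing F n) * ∏ j ∈ Finset.univ.erase i, g j) • dform (g i)) * α)
    (i : Fin r) : ∃ β : FormAlgebra F n, dform (g i) * α = g i • β := by
  have : Module.Free (PolyRing F n) (FormAlgebra F n) := ExteriorAlgebra.free_of_free _ _
  have hprod : ∀ t : Finset (Fin r), i ∉ t → ∀ x, g i ∣ (∏ j ∈ t, g j) * x → g i ∣ x := by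
    intro t
    induction t using Finset.induction_on with
    | empty => simp
    | insert j t hj ih =>
      intro hi x hx
      rw [Finset.mem_insert, not_or] at hi
      rw [Finset.prod_insert hj, mul_assoc] at hx
      exact ih hi.2 x ((hreg i j hi.1).dvd_of_dvd_mul hx)
  have hunit : IsUnit (a i : PolyRing F n) := by
    rw [← map_natCast (MvPolynomial.C (σ := Fin n) (R := F))]
    exact (IsUnit.mk0 _ (ha i)).map _
  have hs : ∀ x, g i ∣ ((a i : PolyRing F n) * ∏ j ∈ Finset.univ.erase i, g j) * x → g i ∣ x := by
    intro x hx
    rw [mul_assoc, hunit.dvd_mul_left] at hx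
    exact hprod _ (Finset.notMem_erase _ _) x hx
  refine Module.Free.exists_eq_smul_of_smul_eq_smul hs
    (m' := (∏ j ∈ Finset.univ.erase i, g j) • ω - ∑ l ∈ Finset.univ.erase i,
      ((a l : PolyRing F n) * ∏ j ∈ (Finset.univ.erase l).erase i, g j) • (dform (g l) * α)) ?_
  rw [← Finset.add_sum_erase _ _ (Finset.mem_univ i), add_mul, Finset.sum_mul,
    ← Finset.mul_prod_erase _ _ (Finset.mem_univ i), mul_smul, smul_mul_assoc] at heq
  rw [smul_sub, heq, Finset.smul_sum, eq_sub_iff_add_eq, add_right_inj]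
  refine Finset.sum_congr rfl fun l hl => ?_
  rw [smul_smul, smul_mul_assoc, mul_left_comm, Finset.mul_prod_erase _ _
    (Finset.mem_erase.2 ⟨(Finset.ne_of_mem_erase hl).symm, Finset.mem_univ i⟩)]

/-- If `f_1,…,f_r` are pairwise regular sequences, `p ∤ a_i`, and
`f_1⋯f_r · ω = (Σ_i a_i f_1⋯f̂_i⋯f_r df_i) ∧ α`, then `df_i ∧ α ∈ f_i · Ω^k` for each `i`. -/
theorem dfi_wedge_alpha_divisible {F : Type} [Field F] {p n : ℕ} [CharP F p] {r : ℕ}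
    (g : Fin r → MvPolynomial (Fin n) F) (a : Fin r → ℕ)
    (ha : ∀ i, 0 < a i) (hpa : ∀ i, ¬ (p ∣ a i))
    (hreg : ∀ i j : Fin r, i ≠ j →
      RingTheory.Sequence.IsRegular (MvPolynomial (Fin n) F) [g i, g j])
    (k : ℕ) (ω α : FormAlgebra F n) (hω : IsForm k ω) (hα : IsForm (k - 1) α)
    (heq : (∏ i, g i) • ω =
      (∑ i, ((a i : PolyRing F n) * ∏ j ∈ Finset.univ.erase i, g j) • dform (g i)) * α) :
    ∀ i : Fin r, ∃ β : FormAlgebra F n, IsForm k β ∧ dform (g i) * α = g i • β := by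
  intro i
  have ha' : ∀ i, (a i : F) ≠ 0 := fun i h => hpa i ((CharP.cast_eq_zero_iff F p _).1 h)
  rw [isForm_iff_mem_exteriorPower] at hω hα
  rcases k with _ | k
  · obtain ⟨c, rfl⟩ := Submodule.mem_one.1 hα
    obtain ⟨w, rfl⟩ := Submodule.mem_one.1 hω
    have hz : c • ∑ i, ((a i : PolyRing F n) * ∏ j ∈ Finset.univ.erase i, g j) •
        (fun l => pderiv l (g i)) = 0 := by
      have := congr(ExteriorAlgebra.ιInv $heq)
      rw [← Algebra.commutes, ← Algebra.smul_def, map_smul, map_smul, map_sum] at this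
      simpa [ExteriorAlgebra.ιInv_algebraMap, dform, ExteriorAlgebra.ι_leftInverse _] using this.symm
    refine ⟨0, AddSubgroup.zero_mem _, ?_⟩
    rcases smul_eq_zero.1 hz with rfl | hz
    · simp
    obtain ⟨β, hβ⟩ := exists_dform_mul_eq_smul (ω := 0) (α := 1) ha' hreg (by
      simpa [dform] using congr(ExteriorAlgebra.ι (PolyRing F n) $hz).symm) i
    have hd : (fun l => pderiv l (g i)) = g i • ExteriorAlgebra.ιInv β := by
      simpa [dform, ExteriorAlgebra.ι_leftInverse _] using congr(ExteriorAlgebra.ιInv $hβ)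
    have : dform (g i) = 0 := by
      rw [dform, ExteriorAlgebra.ι_eq_zero_iff]
      funext l
      exact pderiv_eq_zero_of_dvd ⟨_, congrFun hd l⟩
    simp [this]
  · obtain ⟨β, hβ⟩ := exists_dform_mul_eq_smul ha' hreg heq i
    have hmem : dform (g i) * α ∈ ⋀[PolyRing F n]^(k + 1) (Fin n → PolyRing F n) := by
      rw [ExteriorAlgebra.exteriorPower, pow_succ']
      exact Submodule.mul_mem_mul (LinearMap.mem_range_self _ _) hα
    refine ⟨GradedAlgebra.proj (fun k : ℕ => ⋀[PolyRing F n]^k (Fin n → PolyRing F n)) (k + 1) β,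
      isForm_iff_mem_exteriorPower.2 (SetLike.coe_mem _), ?_⟩
    rw [← map_smul, ← hβ, GradedAlgebra.proj_apply]
    exact (DirectSum.decompose_of_mem_same
      (fun k : ℕ => ⋀[PolyRing F n]^k (Fin n → PolyRing F n)) hmem).symm
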